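/- First-moment combinatorial identity for the staircase transformation: for every Young diagram λ with at most d rows and every i ∈ [d], one has ∑_{k=1}^{d} λ↑↑_k · c²_{k→i} = (λ_i + 1 − i) · D_{d→i}. -/

import Mathlib

open Finset

/-- The Weyl dimension polynomial `WD_p(mu) = prod_{1 <= a < b <= p} ((mu_a - mu_b) + (b - a))/(b - a)`
of the integer tuple `(mu 1, ..., mu p)`. -/
def weylDim (p : ℕ) (μ : ℕ → ℤ) : ℚ :=
  ∏ a ∈ Finset.Icc 1 p, ∏ b ∈ Finset.Icc (a + 1) p,
    (((μ a : ℚ) - (μ b : ℚ)) + ((b : ℚ) - (a : ℚ))) / ((b : ℚ) - (a : ℚ))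

/-- `addBox μ y = μ + e_y`: the tuple `μ` with `1` added in coordinate `y`. -/
def addBox (μ : ℕ → ℤ) (y : ℕ) : ℕ → ℤ := fun x => μ x + if x = y then 1 else 0

/-- The dimension ratio `D^μ_{k→y} = WD_k(μ + e_y)/WD_k(μ)` for `y ≤ k`, and `0` for `k < y`
(division by zero evaluates to `0`). -/
def dimRatio (μ : ℕ → ℤ) (k y : ℕ) : ℚ :=
  if y ≤ k then weylDim k (addBox μ y) / weylDim k μ else 0

/-- `D_{k→i}` for the Young diagram `lam`. -/
def dimR (lam : ℕ → ℕ) (k i : ℕ) : ℚ := dimRatio (fun x => (lam x : ℤ)) k i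

/-- The squared one-step Clebsch–Gordan coefficient `c²_{k→i}`. -/
def csq (lam : ℕ → ℕ) (k i : ℕ) : ℚ :=
  if i ≤ k then
    |(∏ j ∈ (Finset.Icc 1 (k - 1)).erase i,
        ((((lam j : ℚ) - (lam i : ℚ)) + ((i : ℚ) - (j : ℚ))) - 1) /
          (((lam j : ℚ) - (lam i : ℚ)) + ((i : ℚ) - (j : ℚ)))) *
      (1 / ((((lam i : ℚ) - (lam k : ℚ)) + ((k : ℚ) - (i : ℚ))) + (if i = k then 1 else 0)))|
  else 0

/-- The staircase transformation `λ↑↑_k = λ_k + d − 2k + 1`. -/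
def staircase (d : ℕ) (lam : ℕ → ℕ) (k : ℕ) : ℤ :=
  (lam k : ℤ) + (d : ℤ) - 2 * (k : ℤ) + 1

/-- The product of the factors `(C_j - C_i - 1)/(C_j - C_i)` over the rows `j ≤ k`, `j ≠ i`, where
`C_x = lam x - x` is the content of row `x`. -/
def contentProd (lam : ℕ → ℕ) (i k : ℕ) : ℚ :=
  ∏ j ∈ (Finset.Icc 1 k).erase i,
    ((((lam j : ℚ) - (lam i : ℚ)) + ((i : ℚ) - (j : ℚ))) - 1) /
      (((lam j : ℚ) - (lam i : ℚ)) + ((i : ℚ) - (j : ℚ)))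

theorem row_le_row_of_le {d : ℕ} {lam : ℕ → ℕ}
    (hlam : ∀ k, 1 ≤ k → k + 1 ≤ d → lam (k + 1) ≤ lam k)
    {a b : ℕ} (ha : 1 ≤ a) (hab : a ≤ b) (hb : b ≤ d) : lam b ≤ lam a := by
  induction b, hab using Nat.le_induction with
  | base => exact le_rfl
  | succ n hn ih => exact (hlam n (ha.trans hn) hb).trans (ih (by omega))

theorem content_sub_pos {d : ℕ} {lam : ℕ → ℕ}
    (hlam : ∀ k, 1 ≤ k → k + 1 ≤ d → lam (k + 1) ≤ lam k)
    {a b : ℕ} (ha : 1 ≤ a) (hab : a < b) (hb : b ≤ d) :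
    1 ≤ ((lam a : ℚ) - (lam b : ℚ)) + ((b : ℚ) - (a : ℚ)) := by
  have h : (lam b : ℚ) ≤ lam a := by exact_mod_cast row_le_row_of_le hlam ha hab.le hb
  have h' : (a : ℚ) + 1 ≤ b := by exact_mod_cast hab
  linarith

theorem contentProd_succ (lam : ℕ → ℕ) {i k : ℕ} (hik : i ≤ k) :
    contentProd lam i (k + 1) = contentProd lam i k *
      (((((lam (k + 1) : ℚ) - (lam i : ℚ)) + ((i : ℚ) - ((k + 1 : ℕ) : ℚ))) - 1) /
        (((lam (k + 1) : ℚ) - (lam i : ℚ)) + ((i : ℚ) - ((k + 1 : ℕ) : ℚ)))) := by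
  unfold contentProd
  rw [← Finset.insert_Icc_right_eq_Icc_add_one (by omega : 1 ≤ k + 1),
    Finset.erase_insert_of_ne (by omega), Finset.prod_insert (by simp), mul_comm]

theorem contentProd_nonneg {d : ℕ} {lam : ℕ → ℕ}
    (hlam : ∀ k, 1 ≤ k → k + 1 ≤ d → lam (k + 1) ≤ lam k)
    {i k : ℕ} (hi : 1 ≤ i) (hid : i ≤ d) (hk : k ≤ d) : 0 ≤ contentProd lam i k := by
  refine Finset.prod_nonneg fun j hj => ?_
  simp only [Finset.mem_erase, Finset.mem_Icc] at hj
  obtain ⟨hne, hj1, hjk⟩ := hj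
  rcases lt_or_gt_of_ne hne with h | h
  · have := content_sub_pos hlam hj1 h hid
    exact div_nonneg (by linarith) (by linarith)
  · have := content_sub_pos hlam hi h (hjk.trans hk)
    exact div_nonneg_of_nonpos (by linarith) (by linarith)

theorem csq_self {d : ℕ} {lam : ℕ → ℕ}
    (hlam : ∀ k, 1 ≤ k → k + 1 ≤ d → lam (k + 1) ≤ lam k)
    {i : ℕ} (hi : 1 ≤ i) (hid : i ≤ d) : csq lam i i = contentProd lam i i := by
  have h : (Finset.Icc 1 (i - 1)).erase i = (Finset.Icc 1 i).erase i := by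
    ext x
    simp only [Finset.mem_erase, Finset.mem_Icc]
    omega
  have h0 := contentProd_nonneg hlam hi hid hid
  unfold contentProd at h0 ⊢
  simp only [csq, le_refl, if_true, h, sub_self, zero_add, div_one, mul_one]
  exact abs_of_nonneg h0

theorem csq_succ {d : ℕ} {lam : ℕ → ℕ}
    (hlam : ∀ k, 1 ≤ k → k + 1 ≤ d → lam (k + 1) ≤ lam k)
    {i k : ℕ} (hi : 1 ≤ i) (hik : i ≤ k) (hk : k + 1 ≤ d) :
    csq lam (k + 1) i = contentProd lam i k /
      (((lam i : ℚ) - (lam (k + 1) : ℚ)) + (((k + 1 : ℕ) : ℚ) - (i : ℚ))) := by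
  have h0 := contentProd_nonneg hlam hi (by omega) (by omega : k ≤ d)
  have h1 := content_sub_pos hlam hi (by omega : i < k + 1) hk
  unfold csq
  rw [if_pos (by omega), if_neg (by omega), add_zero, Nat.add_sub_cancel, ← contentProd,
    mul_one_div]
  exact abs_of_nonneg (div_nonneg h0 (by linarith))

theorem contentProd_succ_eq_add_csq {d : ℕ} {lam : ℕ → ℕ}
    (hlam : ∀ k, 1 ≤ k → k + 1 ≤ d → lam (k + 1) ≤ lam k)
    {i k : ℕ} (hi : 1 ≤ i) (hik : i ≤ k) (hk : k + 1 ≤ d) :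
    contentProd lam i (k + 1) = contentProd lam i k + csq lam (k + 1) i := by
  have h1 := content_sub_pos hlam hi (by omega : i < k + 1) hk
  rw [csq_succ hlam hi hik hk, contentProd_succ lam hik]
  have h2 : ((lam i : ℚ) - (lam (k + 1) : ℚ)) + (((k + 1 : ℕ) : ℚ) - (i : ℚ)) ≠ 0 := by linarith
  have h3 : ((lam (k + 1) : ℚ) - (lam i : ℚ)) + ((i : ℚ) - ((k + 1 : ℕ) : ℚ)) =
    -(((lam i : ℚ) - (lam (k + 1) : ℚ)) + (((k + 1 : ℕ) : ℚ) - (i : ℚ))) := by ring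
  rw [h3]
  generalize ((lam i : ℚ) - (lam (k + 1) : ℚ)) + (((k + 1 : ℕ) : ℚ) - (i : ℚ)) = x at *
  field_simp
  ring

theorem sum_csq {d : ℕ} {lam : ℕ → ℕ}
    (hlam : ∀ k, 1 ≤ k → k + 1 ≤ d → lam (k + 1) ≤ lam k)
    {i n : ℕ} (hi : 1 ≤ i) (hin : i ≤ n) (hn : n ≤ d) :
    ∑ k ∈ Finset.Icc i n, csq lam k i = contentProd lam i n := by
  induction n, hin using Nat.le_induction with
  | base => simp [csq_self hlam hi hn]
  | succ n hin ih =>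
    rw [Finset.sum_Icc_succ_top (by omega), ih (by omega),
      contentProd_succ_eq_add_csq hlam hi hin hn]

theorem sum_staircase_mul_csq {d : ℕ} {lam : ℕ → ℕ}
    (hlam : ∀ k, 1 ≤ k → k + 1 ≤ d → lam (k + 1) ≤ lam k)
    {i n : ℕ} (hi : 1 ≤ i) (hin : i ≤ n) (hn : n ≤ d) :
    ∑ k ∈ Finset.Icc i n, (staircase n lam k : ℚ) * csq lam k i
      = ((lam i : ℚ) + 1 - (i : ℚ)) * contentProd lam i n := by
  induction n, hin using Nat.le_induction with
  | base =>
    simp only [Finset.Icc_self, Finset.sum_singleton, csq_self hlam hi hn, staircase]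
    push_cast
    ring
  | succ n hin ih =>
    have hstep : ∀ k, (staircase (n + 1) lam k : ℚ) * csq lam k i =
        (staircase n lam k : ℚ) * csq lam k i + csq lam k i := by
      intro k
      simp only [staircase]
      push_cast
      ring
    have hlast : (((lam i : ℚ) - (lam (n + 1) : ℚ)) + (((n + 1 : ℕ) : ℚ) - (i : ℚ))) *
        csq lam (n + 1) i = contentProd lam i n := by
      have := content_sub_pos hlam hi (by omega : i < n + 1) hn
      rw [csq_succ hlam hi hin hn, mul_div_cancel₀ _ (by linarith)]
    rw [Finset.sum_Icc_succ_top (by omega), Finset.sum_congr rfl fun k _ => hstep k,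
      Finset.sum_add_distrib, ih (by omega), sum_csq hlam hi hin (by omega),
      contentProd_succ_eq_add_csq hlam hi hin hn]
    simp only [staircase]
    push_cast at hlast ⊢
    linear_combination -hlast

theorem weylDim_succ (p : ℕ) (μ : ℕ → ℤ) :
    weylDim (p + 1) μ = weylDim p μ * ∏ a ∈ Finset.Icc 1 p,
      (((μ a : ℚ) - (μ (p + 1) : ℚ)) + (((p + 1 : ℕ) : ℚ) - (a : ℚ))) /
        (((p + 1 : ℕ) : ℚ) - (a : ℚ)) := by
  unfold weylDim
  rw [Finset.prod_Icc_succ_top (by omega), Finset.Icc_eq_empty (by omega : ¬ p + 1 + 1 ≤ p + 1),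
    Finset.prod_empty, mul_one, ← Finset.prod_mul_distrib]
  refine Finset.prod_congr rfl fun a ha => ?_
  rw [Finset.prod_Icc_succ_top (by have := (Finset.mem_Icc.1 ha).2; omega)]

theorem weylDim_congr {p : ℕ} {μ ν : ℕ → ℤ} (h : ∀ a ≤ p, μ a = ν a) :
    weylDim p μ = weylDim p ν := by
  refine Finset.prod_congr rfl fun a ha => Finset.prod_congr rfl fun b hb => ?_
  rw [h a (Finset.mem_Icc.1 ha).2, h b (Finset.mem_Icc.1 hb).2]

theorem weylDim_ne_zero {d : ℕ} {lam : ℕ → ℕ}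
    (hlam : ∀ k, 1 ≤ k → k + 1 ≤ d → lam (k + 1) ≤ lam k) :
    weylDim d (fun x => (lam x : ℤ)) ≠ 0 := by
  refine Finset.prod_ne_zero_iff.2 fun a ha => Finset.prod_ne_zero_iff.2 fun b hb => ?_
  simp only [Finset.mem_Icc] at ha hb
  have h := content_sub_pos hlam ha.1 (by omega : a < b) hb.2
  have h' : (a : ℚ) + 1 ≤ b := by exact_mod_cast hb.1
  push_cast
  exact div_ne_zero (by linarith) (by linarith)

theorem weylDim_addBox {d : ℕ} {lam : ℕ → ℕ}
    (hlam : ∀ k, 1 ≤ k → k + 1 ≤ d → lam (k + 1) ≤ lam k)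
    {i n : ℕ} (hi : 1 ≤ i) (hin : i ≤ n) (hn : n ≤ d) :
    weylDim n (addBox (fun x => (lam x : ℤ)) i) =
      weylDim n (fun x => (lam x : ℤ)) * contentProd lam i n := by
  induction n, hin using Nat.le_induction with
  | base =>
    obtain ⟨m, rfl⟩ : ∃ m, i = m + 1 := ⟨i - 1, by omega⟩
    have hset : (Finset.Icc 1 (m + 1)).erase (m + 1) = Finset.Icc 1 m := by
      ext x
      simp only [Finset.mem_erase, Finset.mem_Icc]
      omega
    rw [weylDim_succ, weylDim_succ, contentProd, hset, mul_assoc, ← Finset.prod_mul_distrib]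
    congr 1
    · exact weylDim_congr fun a ha => by simp [addBox, show a ≠ m + 1 by omega]
    · refine Finset.prod_congr rfl fun a ha => ?_
      rw [Finset.mem_Icc] at ha
      have h := content_sub_pos hlam ha.1 (by omega : a < m + 1) hn
      have h' : ((m + 1 : ℕ) : ℚ) - a ≠ 0 := by
        have : (a : ℚ) ≤ m := by exact_mod_cast ha.2
        push_cast
        linarith
      have hx : ((lam a : ℚ) - (lam (m + 1) : ℚ)) + (((m + 1 : ℕ) : ℚ) - (a : ℚ)) ≠ 0 := by
        linarith
      simp only [addBox, show a ≠ m + 1 by omega, if_true, if_false, Int.cast_add, Int.cast_one,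
        Int.cast_natCast, add_zero]
      field_simp
      ring
  | succ n hin ih =>
    have hmem : i ∈ Finset.Icc 1 n := Finset.mem_Icc.2 ⟨hi, hin⟩
    rw [weylDim_succ, weylDim_succ, ih (by omega), contentProd_succ lam hin,
      ← Finset.mul_prod_erase _ _ hmem, ← Finset.mul_prod_erase _ _ hmem]
    have hcongr : ∀ a ∈ (Finset.Icc 1 n).erase i,
        (((addBox (fun x => (lam x : ℤ)) i a : ℚ) -
          (addBox (fun x => (lam x : ℤ)) i (n + 1) : ℚ)) + (((n + 1 : ℕ) : ℚ) - (a : ℚ))) /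
            (((n + 1 : ℕ) : ℚ) - (a : ℚ)) =
        ((((lam a : ℤ) : ℚ) - ((lam (n + 1) : ℤ) : ℚ)) + (((n + 1 : ℕ) : ℚ) - (a : ℚ))) /
            (((n + 1 : ℕ) : ℚ) - (a : ℚ)) := by
      intro a ha
      simp [addBox, (Finset.mem_erase.1 ha).1, show n + 1 ≠ i by omega]
    rw [Finset.prod_congr rfl hcongr]
    have h := content_sub_pos hlam hi (by omega : i < n + 1) hn
    have hy : ((n + 1 : ℕ) : ℚ) - i ≠ 0 := by
      have : (i : ℚ) ≤ n := by exact_mod_cast hin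
      push_cast
      linarith
    have hx : ((lam (n + 1) : ℚ) - (lam i : ℚ)) + ((i : ℚ) - ((n + 1 : ℕ) : ℚ)) ≠ 0 := by
      linarith
    simp only [addBox, show n + 1 ≠ i by omega, if_true, if_false, Int.cast_add, Int.cast_one,
      Int.cast_natCast, add_zero]
    field_simp
    ring

theorem dimR_eq_contentProd {d : ℕ} {lam : ℕ → ℕ}
    (hlam : ∀ k, 1 ≤ k → k + 1 ≤ d → lam (k + 1) ≤ lam k)
    {i : ℕ} (hi : 1 ≤ i) (hid : i ≤ d) : dimR lam d i = contentProd lam i d := by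
  rw [dimR, dimRatio, if_pos hid, weylDim_addBox hlam hi hid le_rfl,
    mul_div_cancel_left₀ _ (weylDim_ne_zero hlam)]

theorem first_moment_staircase
    (d : ℕ) (hd : 1 ≤ d) (lam : ℕ → ℕ)
    (hlam : ∀ k, 1 ≤ k → k + 1 ≤ d → lam (k + 1) ≤ lam k)
    (i : ℕ) (hi : i ∈ Finset.Icc 1 d) :
    ∑ k ∈ Finset.Icc 1 d, (staircase d lam k : ℚ) * csq lam k i
      = ((lam i : ℚ) + 1 - (i : ℚ)) * dimR lam d i := by
  obtain ⟨hi1, hid⟩ := Finset.mem_Icc.1 hi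
  rw [dimR_eq_contentProd hlam hi1 hid, ← sum_staircase_mul_csq hlam hi1 hid le_rfl]
  refine (Finset.sum_subset (Finset.Icc_subset_Icc_left hi1) fun k hk hk' => ?_).symm
  rw [Finset.mem_Icc] at hk hk'
  rw [csq, if_neg (by omega), mul_zero]
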